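/- arXiv:2005.12699 — 2 statements merged into one kernel-verified Lean document; each statement's English description precedes it below -/
import Mathlib

section
/- Let x₀ > 0 and y₀ > 0, and let f, g : [0,x₀] × [0,y₀] → ℝ be continuous nonnegative functions. Suppose there exist nonnegative constants J, c₁, c₂ and a constant K ≥ 1 such that for every (x,y) ∈ [0,x₀] × [0,y₀] one has f(x,y) + g(x,y) ≤ K·(J + c₁·∫₀ˣ f(x',y) dx' + c₂·∫₀ʸ g(x,y') dy'). Then for every (x,y) ∈ [0,x₀] × [0,y₀], f(x,y) + g(x,y) ≤ 2·K·J·exp(4·K·(c₁·x + c₂·y)). -/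
open Set MeasureTheory intervalIntegral

/-- A function dominated by `M * exp (l * (c * t + d))` on `[0, x]` has integral, scaled by `c`,
at most `M / l * exp (l * (c * x + d))`. -/
theorem mul_integral_le_of_le_exp {h : ℝ → ℝ} {x c d l M : ℝ} (hx : 0 ≤ x) (hc : 0 ≤ c)
    (hl : 0 < l) (hM : 0 ≤ M) (hcont : ContinuousOn h (Icc 0 x))
    (hle : ∀ t ∈ Icc 0 x, h t ≤ M * Real.exp (l * (c * t + d))) :
    c * (∫ t in (0:ℝ)..x, h t) ≤ M / l * Real.exp (l * (c * x + d)) := by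
  have hmono : (∫ t in (0:ℝ)..x, h t) ≤ ∫ t in (0:ℝ)..x, M * Real.exp (l * (c * t + d)) :=
    integral_mono_on hx (hcont.intervalIntegrable_of_Icc hx)
      (Continuous.intervalIntegrable (by fun_prop) _ _) hle
  have hderiv : ∀ t ∈ uIcc 0 x, HasDerivAt (fun t => M / l * Real.exp (l * (c * t + d)))
      (c * (M * Real.exp (l * (c * t + d)))) t := fun t _ => by
    refine (((((hasDerivAt_id' t).const_mul c).add_const d).const_mul l).exp.const_mul
      (M / l)).congr_deriv ?_
    field_simp
  calc c * (∫ t in (0:ℝ)..x, h t)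
      ≤ c * ∫ t in (0:ℝ)..x, M * Real.exp (l * (c * t + d)) :=
        mul_le_mul_of_nonneg_left hmono hc
    _ = M / l * Real.exp (l * (c * x + d)) - M / l * Real.exp (l * (c * 0 + d)) := by
        rw [← intervalIntegral.integral_const_mul]
        exact integral_eq_sub_of_hasDerivAt hderiv
          (Continuous.intervalIntegrable (by fun_prop) _ _)
    _ ≤ M / l * Real.exp (l * (c * x + d)) := sub_le_self _ (by positivity)

/-- Two-variable Grönwall lemma (Lemma 7.6 of the paper, after
Klainerman–Rodnianski, Lemma 14.8), with explicit constants. -/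
theorem two_variable_gronwall
    (x₀ y₀ : ℝ) (hx₀ : 0 < x₀) (hy₀ : 0 < y₀)
    (f g : ℝ → ℝ → ℝ)
    (hf_cont : ContinuousOn (fun p : ℝ × ℝ => f p.1 p.2) (Icc 0 x₀ ×ˢ Icc 0 y₀))
    (hg_cont : ContinuousOn (fun p : ℝ × ℝ => g p.1 p.2) (Icc 0 x₀ ×ˢ Icc 0 y₀))
    (hf_nonneg : ∀ x ∈ Icc (0:ℝ) x₀, ∀ y ∈ Icc (0:ℝ) y₀, 0 ≤ f x y)
    (hg_nonneg : ∀ x ∈ Icc (0:ℝ) x₀, ∀ y ∈ Icc (0:ℝ) y₀, 0 ≤ g x y)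
    (J c₁ c₂ K : ℝ) (hJ : 0 ≤ J) (hc₁ : 0 ≤ c₁) (hc₂ : 0 ≤ c₂) (hK : 1 ≤ K)
    (hineq : ∀ x ∈ Icc (0:ℝ) x₀, ∀ y ∈ Icc (0:ℝ) y₀,
      f x y + g x y ≤
        K * (J + c₁ * (∫ x' in (0:ℝ)..x, f x' y) + c₂ * (∫ y' in (0:ℝ)..y, g x y'))) :
    ∀ x ∈ Icc (0:ℝ) x₀, ∀ y ∈ Icc (0:ℝ) y₀,
      f x y + g x y ≤ 2 * K * J * Real.exp (4 * K * (c₁ * x + c₂ * y)) := by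
  have hK0 : 0 < K := zero_lt_one.trans_le hK
  have hcont : ContinuousOn (fun p : ℝ × ℝ => (f p.1 p.2 + g p.1 p.2) *
      Real.exp (-(4 * K * (c₁ * p.1 + c₂ * p.2)))) (Icc 0 x₀ ×ˢ Icc 0 y₀) :=
    (hf_cont.add hg_cont).mul (Continuous.continuousOn (by fun_prop))
  obtain ⟨⟨a, b⟩, ⟨ha, hb⟩, hmax⟩ := (isCompact_Icc.prod isCompact_Icc).exists_isMaxOn
    ⟨(0, 0), left_mem_Icc.2 hx₀.le, left_mem_Icc.2 hy₀.le⟩ hcont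
  simp only at ha hb
  obtain ⟨M, hM⟩ : ∃ M, M = (f a b + g a b) * Real.exp (-(4 * K * (c₁ * a + c₂ * b))) := ⟨_, rfl⟩
  have hM0 : 0 ≤ M := by
    rw [hM]
    exact mul_nonneg (add_nonneg (hf_nonneg a ha b hb) (hg_nonneg a ha b hb)) (Real.exp_nonneg _)
  have hbound : ∀ x ∈ Icc (0:ℝ) x₀, ∀ y ∈ Icc (0:ℝ) y₀,
      f x y + g x y ≤ M * Real.exp (4 * K * (c₁ * x + c₂ * y)) := fun x hx y hy => by
    have h : (f x y + g x y) * Real.exp (-(4 * K * (c₁ * x + c₂ * y))) ≤ M := by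
      rw [hM]
      exact hmax (show (x, y) ∈ Icc 0 x₀ ×ˢ Icc 0 y₀ from ⟨hx, hy⟩)
    rwa [Real.exp_neg, ← div_eq_mul_inv, div_le_iff₀ (Real.exp_pos _)] at h
  have hMab : f a b + g a b = M * Real.exp (4 * K * (c₁ * a + c₂ * b)) := by
    rw [hM, mul_assoc, ← Real.exp_add, neg_add_cancel, Real.exp_zero, mul_one]
  have hf_int : c₁ * (∫ x' in (0:ℝ)..a, f x' b) ≤
      M / (4 * K) * Real.exp (4 * K * (c₁ * a + c₂ * b)) := by
    have hsub : Icc 0 a ⊆ Icc 0 x₀ := Icc_subset_Icc_right ha.2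
    refine mul_integral_le_of_le_exp ha.1 hc₁ (by positivity) hM0
      (hf_cont.comp (f := fun t => (t, b)) (by fun_prop) fun t ht => ⟨hsub ht, hb⟩)
      fun t ht => ?_
    linarith [hbound t (hsub ht) b hb, hg_nonneg t (hsub ht) b hb]
  have hg_int : c₂ * (∫ y' in (0:ℝ)..b, g a y') ≤
      M / (4 * K) * Real.exp (4 * K * (c₁ * a + c₂ * b)) := by
    have hsub : Icc 0 b ⊆ Icc 0 y₀ := Icc_subset_Icc_right hb.2
    rw [add_comm (c₁ * a)]
    refine mul_integral_le_of_le_exp hb.1 hc₂ (by positivity) hM0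
      (hg_cont.comp (f := fun t => (a, t)) (by fun_prop) fun t ht => ⟨ha, hsub ht⟩)
      fun t ht => ?_
    rw [add_comm (c₂ * t)]
    linarith [hbound a ha t (hsub ht), hf_nonneg a ha t (hsub ht)]
  have hM_le : M ≤ 2 * K * J := by
    have hE : 1 ≤ Real.exp (4 * K * (c₁ * a + c₂ * b)) :=
      Real.one_le_exp (mul_nonneg (by positivity)
        (add_nonneg (mul_nonneg hc₁ ha.1) (mul_nonneg hc₂ hb.1)))
    have hab := hineq a ha b hb
    rw [hMab] at hab
    generalize Real.exp (4 * K * (c₁ * a + c₂ * b)) = E at *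
    have hle : M * E ≤ K * J + M * E / 2 := calc
      M * E ≤ K * (J + M / (4 * K) * E + M / (4 * K) * E) := hab.trans (by gcongr)
      _ = K * J + M * E / 2 := by field_simp; ring
    linarith [le_mul_of_one_le_right hM0 hE]
  exact fun x hx y hy => (hbound x hx y hy).trans
    (mul_le_mul_of_nonneg_right hM_le (Real.exp_nonneg _))
end

section
/- Let x₀ > 0 and y₀ > 0, let f, g : [0,x₀] × [0,y₀] → ℝ be continuous nonnegative functions, let p : [0,x₀] → ℝ and q : [0,y₀] → ℝ be continuous nonnegative functions, and let J ≥ 0. Suppose that for every (x,y) ∈ [0,x₀] × [0,y₀] one has f(x,y) + g(x,y) ≤ J + ∫₀ˣ p(x')·f(x',y) dx' + ∫₀ʸ q(y')·g(x,y') dy'. Then for every (x,y) ∈ [0,x₀] × [0,y₀], f(x,y) + g(x,y) ≤ 2·J·exp(4·(∫₀ˣ p(x') dx' + ∫₀ʸ q(y') dy')). -/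
open Set MeasureTheory intervalIntegral

/-- The primitive of a continuous function is continuous on the interval of definition. -/
theorem continuousOn_primitive_Icc {p : ℝ → ℝ} {a : ℝ} (ha : 0 ≤ a)
    (hp : ContinuousOn p (Icc 0 a)) :
    ContinuousOn (fun x => ∫ t in (0:ℝ)..x, p t) (Icc 0 a) := by
  have hint : IntegrableOn p (uIcc 0 a) := by
    rw [uIcc_of_le ha]
    exact hp.integrableOn_Icc
  simpa only [uIcc_of_le ha] using intervalIntegral.continuousOn_primitive_interval hint

/-- Weighting by the coefficient `p` integrates `exp (c * ∫ p)` exactly. -/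
theorem integral_mul_exp_primitive {p : ℝ → ℝ} {a c : ℝ} (ha : 0 ≤ a) (hc : c ≠ 0)
    (hp : ContinuousOn p (Icc 0 a)) :
    ∫ x in (0:ℝ)..a, p x * Real.exp (c * ∫ t in (0:ℝ)..x, p t) =
      (Real.exp (c * ∫ t in (0:ℝ)..a, p t) - 1) / c := by
  have hP := continuousOn_primitive_Icc ha hp
  have hE : ContinuousOn (fun x => Real.exp (c * ∫ t in (0:ℝ)..x, p t)) (Icc 0 a) :=
    (hP.const_mul c).rexp
  have hderiv : ∀ x ∈ Ioo 0 a,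
      HasDerivAt (fun x => Real.exp (c * ∫ t in (0:ℝ)..x, p t) / c)
        (p x * Real.exp (c * ∫ t in (0:ℝ)..x, p t)) x := by
    intro x hx
    have hPx : HasDerivAt (fun x => ∫ t in (0:ℝ)..x, p t) (p x) x :=
      intervalIntegral.integral_hasDerivAt_right
        ((hp.mono (Icc_subset_Icc_right hx.2.le)).intervalIntegrable_of_Icc hx.1.le)
        ((hp.mono Ioo_subset_Icc_self).stronglyMeasurableAtFilter isOpen_Ioo x hx)
        (hp.continuousAt (Icc_mem_nhds hx.1 hx.2))
    refine (((hPx.const_mul c).exp).div_const c).congr_deriv ?_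
    field_simp
  rw [intervalIntegral.integral_eq_sub_of_hasDerivAt_of_le ha (hE.div_const c) hderiv
    ((hp.mul hE).intervalIntegrable_of_Icc ha)]
  simp [sub_div]

/-- A function bounded by `C * exp (c * ∫ p)` has `p`-weighted integral at most
`C / c * exp (c * ∫ p)`. -/
theorem integral_mul_le_of_le_exp_primitive {p h : ℝ → ℝ} {a c C : ℝ} (ha : 0 ≤ a) (hc : 0 < c)
    (hC : 0 ≤ C) (hp : ContinuousOn p (Icc 0 a)) (hp_nonneg : ∀ x ∈ Icc 0 a, 0 ≤ p x)
    (hh : ContinuousOn h (Icc 0 a))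
    (hle : ∀ x ∈ Icc 0 a, h x ≤ C * Real.exp (c * ∫ t in (0:ℝ)..x, p t)) :
    ∫ x in (0:ℝ)..a, p x * h x ≤ C / c * Real.exp (c * ∫ t in (0:ℝ)..a, p t) := by
  have hE : ContinuousOn (fun x => Real.exp (c * ∫ t in (0:ℝ)..x, p t)) (Icc 0 a) :=
    ((continuousOn_primitive_Icc ha hp).const_mul c).rexp
  calc ∫ x in (0:ℝ)..a, p x * h x
      ≤ ∫ x in (0:ℝ)..a, C * (p x * Real.exp (c * ∫ t in (0:ℝ)..x, p t)) := by
        refine intervalIntegral.integral_mono_on ha ((hp.mul hh).intervalIntegrable_of_Icc ha)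
          (((hp.mul hE).const_mul C).intervalIntegrable_of_Icc ha) fun x hx => ?_
        exact (mul_le_mul_of_nonneg_left (hle x hx) (hp_nonneg x hx)).trans_eq (by ring)
    _ = C / c * (Real.exp (c * ∫ t in (0:ℝ)..a, p t) - 1) := by
        rw [intervalIntegral.integral_const_mul, integral_mul_exp_primitive ha hc.ne' hp]
        ring
    _ ≤ C / c * Real.exp (c * ∫ t in (0:ℝ)..a, p t) :=
        mul_le_mul_of_nonneg_left (by linarith) (by positivity)

/-- Variable-coefficient form of the two-variable Grönwall lemma
(Section 7 of the paper). -/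
theorem two_variable_gronwall_variable_coefficients
    (x₀ y₀ : ℝ) (hx₀ : 0 < x₀) (hy₀ : 0 < y₀)
    (f g : ℝ → ℝ → ℝ) (p q : ℝ → ℝ)
    (hf_cont : ContinuousOn (fun pt : ℝ × ℝ => f pt.1 pt.2) (Icc 0 x₀ ×ˢ Icc 0 y₀))
    (hg_cont : ContinuousOn (fun pt : ℝ × ℝ => g pt.1 pt.2) (Icc 0 x₀ ×ˢ Icc 0 y₀))
    (hf_nonneg : ∀ x ∈ Icc (0:ℝ) x₀, ∀ y ∈ Icc (0:ℝ) y₀, 0 ≤ f x y)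
    (hg_nonneg : ∀ x ∈ Icc (0:ℝ) x₀, ∀ y ∈ Icc (0:ℝ) y₀, 0 ≤ g x y)
    (hp_cont : ContinuousOn p (Icc 0 x₀)) (hq_cont : ContinuousOn q (Icc 0 y₀))
    (hp_nonneg : ∀ x ∈ Icc (0:ℝ) x₀, 0 ≤ p x)
    (hq_nonneg : ∀ y ∈ Icc (0:ℝ) y₀, 0 ≤ q y)
    (J : ℝ) (hJ : 0 ≤ J)
    (hineq : ∀ x ∈ Icc (0:ℝ) x₀, ∀ y ∈ Icc (0:ℝ) y₀,
      f x y + g x y ≤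
        J + (∫ x' in (0:ℝ)..x, p x' * f x' y) + (∫ y' in (0:ℝ)..y, q y' * g x y')) :
    ∀ x ∈ Icc (0:ℝ) x₀, ∀ y ∈ Icc (0:ℝ) y₀,
      f x y + g x y ≤
        2 * J * Real.exp (4 * ((∫ x' in (0:ℝ)..x, p x') + (∫ y' in (0:ℝ)..y, q y'))) := by
  have hP := continuousOn_primitive_Icc hx₀.le hp_cont
  have hQ := continuousOn_primitive_Icc hy₀.le hq_cont
  set P : ℝ → ℝ := fun x => ∫ t in (0:ℝ)..x, p t
  set Q : ℝ → ℝ := fun y => ∫ t in (0:ℝ)..y, q t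
  have hF : ContinuousOn
      (fun z : ℝ × ℝ => (f z.1 z.2 + g z.1 z.2) * Real.exp (-(4 * (P z.1 + Q z.2))))
      (Icc 0 x₀ ×ˢ Icc 0 y₀) :=
    (hf_cont.add hg_cont).mul (((hP.comp continuousOn_fst fun _ hz => hz.1).add
      (hQ.comp continuousOn_snd fun _ hz => hz.2)).const_mul 4).neg.rexp
  obtain ⟨⟨a, b⟩, ⟨ha, hb⟩, hmax⟩ := (isCompact_Icc.prod isCompact_Icc).exists_isMaxOn
    ⟨((0:ℝ), (0:ℝ)), left_mem_Icc.2 hx₀.le, left_mem_Icc.2 hy₀.le⟩ hF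
  obtain ⟨M, hM⟩ : ∃ M, M = (f a b + g a b) * Real.exp (-(4 * (P a + Q b))) := ⟨_, rfl⟩
  have hM_nonneg : 0 ≤ M := by
    rw [hM]
    exact mul_nonneg (add_nonneg (hf_nonneg a ha b hb) (hg_nonneg a ha b hb)) (Real.exp_nonneg _)
  have hbound : ∀ x ∈ Icc (0:ℝ) x₀, ∀ y ∈ Icc (0:ℝ) y₀,
      f x y + g x y ≤ M * Real.exp (4 * (P x + Q y)) := by
    intro x hx y hy
    have h : (f x y + g x y) * Real.exp (-(4 * (P x + Q y))) ≤ M :=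
      (isMaxOn_iff.1 hmax (x, y) ⟨hx, hy⟩).trans_eq hM.symm
    rwa [Real.exp_neg, ← div_eq_mul_inv, div_le_iff₀ (Real.exp_pos _)] at h
  have hab : Icc 0 a ⊆ Icc 0 x₀ := Icc_subset_Icc_right ha.2
  have hbb : Icc 0 b ⊆ Icc 0 y₀ := Icc_subset_Icc_right hb.2
  have hIf : ∫ x in (0:ℝ)..a, p x * f x b ≤
      M * Real.exp (4 * Q b) / 4 * Real.exp (4 * P a) := by
    refine integral_mul_le_of_le_exp_primitive ha.1 four_pos (by positivity) (hp_cont.mono hab)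
      (fun x hx => hp_nonneg x (hab hx)) (hf_cont.comp (f := fun x : ℝ => (x, b)) (by fun_prop)
        fun x hx => ⟨hab hx, hb⟩) fun x hx => ?_
    have h := hbound x (hab hx) b hb
    rw [mul_add, Real.exp_add] at h
    linarith [hg_nonneg x (hab hx) b hb]
  have hIg : ∫ y in (0:ℝ)..b, q y * g a y ≤
      M * Real.exp (4 * P a) / 4 * Real.exp (4 * Q b) := by
    refine integral_mul_le_of_le_exp_primitive hb.1 four_pos (by positivity) (hq_cont.mono hbb)
      (fun y hy => hq_nonneg y (hbb hy)) (hg_cont.comp (f := fun y : ℝ => (a, y)) (by fun_prop)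
        fun y hy => ⟨ha, hbb hy⟩) fun y hy => ?_
    have h := hbound a ha y (hbb hy)
    rw [mul_add, Real.exp_add] at h
    linarith [hf_nonneg a ha y (hbb hy)]
  have hPa : 0 ≤ P a := intervalIntegral.integral_nonneg ha.1 fun x hx => hp_nonneg x (hab hx)
  have hQb : 0 ≤ Q b := intervalIntegral.integral_nonneg hb.1 fun y hy => hq_nonneg y (hbb hy)
  have hM_le : M ≤ 2 * J := by
    have hE : 1 ≤ Real.exp (4 * (P a + Q b)) := Real.one_le_exp (by positivity)
    have hMeq : M * Real.exp (4 * (P a + Q b)) = f a b + g a b := by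
      rw [hM, mul_assoc, ← Real.exp_add, neg_add_cancel, Real.exp_zero, mul_one]
    have hsplit : Real.exp (4 * (P a + Q b)) = Real.exp (4 * P a) * Real.exp (4 * Q b) := by
      rw [mul_add, Real.exp_add]
    have hself : M * Real.exp (4 * (P a + Q b)) ≤ 2 * J := by
      have h := hineq a ha b hb
      rw [hsplit] at hMeq ⊢
      linarith
    exact (le_mul_of_one_le_right hM_nonneg hE).trans hself
  intro x hx y hy
  exact (hbound x hx y hy).trans (mul_le_mul_of_nonneg_right hM_le (Real.exp_nonneg _))
end
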